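/- arXiv:2310.14691 — 7 statements merged into one kernel-verified Lean document; each statement's English description precedes it below -/
import Mathlib

section
/- Let G^e be the ESCG derived from some FTCG satisfying temporal priority, maximal lag γ_max, consistency throughout time and acyclicity. Let X, Y ∈ V be distinct, t ∈ ℤ and γ ≥ 0 an integer, and assume that γ ≥ 1, or that γ = 0 and Y_t → X_t is not an edge of G^e. Then the set B_γ satisfies the backdoor criterion over all candidate FTCGs relative to ((X,t−γ),(Y,t)). (Graph-theoretic form of Theorem 1: the total effect P(y_t | do(x_{t−γ})) is identifiable in G^e, with B_γ a valid adjustment set.) -/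
/-- `u` is an ancestor of `v` (equivalently, `v` is a descendant of `u`):
there is a possibly empty directed path from `u` to `v` in the directed graph
with edge relation `E`. -/
def Anc {α : Type*} (E : α → α → Prop) (u v : α) : Prop :=
  Relation.ReflTransGen E u v

/-- A directed graph is acyclic if there is no nonempty directed path
from a vertex to itself. -/
def Acyclic {α : Type*} (E : α → α → Prop) : Prop :=
  ∀ v, ¬ Relation.TransGen E v v

/-- A path in a directed graph, given as a sequence of `n + 1` pairwise
distinct vertices `w 0, …, w n` (with `n ≥ 1`) together with a chosen
direction for each step: `dir i = true` means the chosen edge is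
`w i → w (i+1)`, and `dir i = false` means it is `w (i+1) → w i`. -/
structure DPath {α : Type*} (E : α → α → Prop) where
  n : ℕ
  pos : 1 ≤ n
  w : ℕ → α
  dir : ℕ → Bool
  inj : ∀ i j, i ≤ n → j ≤ n → w i = w j → i = j
  valid : ∀ i, i < n →
    (dir i = true → E (w i) (w (i + 1))) ∧ (dir i = false → E (w (i + 1)) (w i))

/-- The path runs between `u` and `v`. -/
def DPath.Between {α : Type*} {E : α → α → Prop} (π : DPath E) (u v : α) : Prop :=
  π.w 0 = u ∧ π.w π.n = v

/-- A backdoor path: the first chosen edge points into the first vertex. -/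
def DPath.Backdoor {α : Type*} {E : α → α → Prop} (π : DPath E) : Prop :=
  π.dir 0 = false

/-- The non-endpoint vertex at position `i` is a collider on the path:
both chosen edges at it point into it. -/
def DPath.ColliderAt {α : Type*} {E : α → α → Prop} (π : DPath E) (i : ℕ) : Prop :=
  0 < i ∧ i < π.n ∧ π.dir (i - 1) = true ∧ π.dir i = false

/-- The non-endpoint vertex at position `i` is a definite non-collider:
at least one of the two chosen edges at it points out of it. -/
def DPath.DefNonColliderAt {α : Type*} {E : α → α → Prop} (π : DPath E) (i : ℕ) : Prop :=
  0 < i ∧ i < π.n ∧ (π.dir (i - 1) = false ∨ π.dir i = true)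

/-- A set `Z` blocks a path if some definite non-collider on the path belongs
to `Z`, or some collider on the path has no descendant in `Z`. -/
def Blocks {α : Type*} {E : α → α → Prop} (Z : Set α) (π : DPath E) : Prop :=
  (∃ i, π.DefNonColliderAt i ∧ π.w i ∈ Z) ∨
  (∃ i, π.ColliderAt i ∧ ∀ z ∈ Z, ¬ Anc E (π.w i) z)

/-- Map a path along an inclusion of edge relations (same vertices, same
chosen directions). -/
def DPath.map {α : Type*} {E E' : α → α → Prop} (h : ∀ a b, E a b → E' a b)
    (π : DPath E) : DPath E' where
  n := π.n
  pos := π.pos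
  w := π.w
  dir := π.dir
  inj := π.inj
  valid := fun i hi =>
    ⟨fun hd => h _ _ ((π.valid i hi).1 hd), fun hd => h _ _ ((π.valid i hi).2 hd)⟩

/-- Temporal priority: every edge goes weakly forward in time, and strictly
forward between two instances of the same time series. -/
def TemporalPriority {V : Type*} (F : V × ℤ → V × ℤ → Prop) : Prop :=
  ∀ A B : V, ∀ s t : ℤ, F (A, s) (B, t) → s ≤ t ∧ (A = B → s < t)

/-- Maximal lag `γmax`: every edge has lag at most `γmax`. -/
def MaxLag {V : Type*} (γmax : ℤ) (F : V × ℤ → V × ℤ → Prop) : Prop :=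
  ∀ A B : V, ∀ s t : ℤ, F (A, s) (B, t) → t - s ≤ γmax

/-- Consistency throughout time: the edge relation is invariant under
simultaneous time shifts. -/
def ConsistentThroughTime {V : Type*} (F : V × ℤ → V × ℤ → Prop) : Prop :=
  ∀ A B : V, ∀ s t k : ℤ, F (A, s) (B, t) ↔ F (A, s + k) (B, t + k)

/-- The extended summary causal graph (ESCG) derived from an FTCG `F`:
vertices `Sum.inl A` represent `A_{t^-}` (past slice) and `Sum.inr A`
represent `A_t` (present slice). -/
def derivedESCG {V : Type*} (γmax : ℤ) (F : V × ℤ → V × ℤ → Prop) :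
    (V ⊕ V) → (V ⊕ V) → Prop
  | Sum.inr A, Sum.inr B => F (A, 0) (B, 0)
  | Sum.inl A, Sum.inr B => ∃ γ : ℤ, 1 ≤ γ ∧ γ ≤ γmax ∧ F (A, -γ) (B, 0)
  | _, _ => False

/-- A candidate FTCG for an ESCG `e`: an FTCG satisfying temporal priority,
maximal lag `γmax`, consistency throughout time and acyclicity whose derived
ESCG is `e`. -/
def CandidateESCG {V : Type*} (γmax : ℤ) (e : (V ⊕ V) → (V ⊕ V) → Prop)
    (F : V × ℤ → V × ℤ → Prop) : Prop :=
  TemporalPriority F ∧ MaxLag γmax F ∧ ConsistentThroughTime F ∧ Acyclic F ∧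
    derivedESCG γmax F = e

/-- The summary causal graph (SCG) derived from an FTCG `F`. -/
def derivedSCG {V : Type*} (γmax : ℤ) (F : V × ℤ → V × ℤ → Prop) : V → V → Prop :=
  fun A B => ∃ t γ : ℤ, 0 ≤ γ ∧ γ ≤ γmax ∧ F (A, t - γ) (B, t)

/-- A candidate FTCG for an SCG `S`. -/
def CandidateSCG {V : Type*} (γmax : ℤ) (S : V → V → Prop)
    (F : V × ℤ → V × ℤ → Prop) : Prop :=
  TemporalPriority F ∧ MaxLag γmax F ∧ ConsistentThroughTime F ∧ Acyclic F ∧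
    derivedSCG γmax F = S

/-- The densest candidate FTCG for an ESCG `e`. -/
def densestFTCG {V : Type*} (γmax : ℤ) (e : (V ⊕ V) → (V ⊕ V) → Prop) :
    V × ℤ → V × ℤ → Prop :=
  fun p q =>
    (p.2 = q.2 ∧ e (Sum.inr p.1) (Sum.inr q.1)) ∨
    (∃ ℓ : ℤ, 1 ≤ ℓ ∧ ℓ ≤ γmax ∧ p.2 = q.2 - ℓ ∧ e (Sum.inl p.1) (Sum.inr q.1))

/-- The adjustment set `B_γ` for an ESCG `e`, variable `X`, time `t`, lag `γ`. -/
def Bset {V : Type*} (γmax : ℤ) (e : (V ⊕ V) → (V ⊕ V) → Prop)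
    (X : V) (t γ : ℤ) : Set (V × ℤ) :=
  {p | (∃ ℓ : ℤ, 1 ≤ ℓ ∧ ℓ ≤ γmax ∧ p.2 = t - γ - ℓ ∧ e (Sum.inl p.1) (Sum.inr X)) ∨
       (p.2 = t - γ ∧ e (Sum.inr p.1) (Sum.inr X))}

/-- The adjustment set `A_γ` for an SCG `S`, variable `X`, time `t`, lag `γ`. -/
def Aset {V : Type*} (γmax : ℤ) (S : V → V → Prop) (X : V) (t γ : ℤ) :
    Set (V × ℤ) :=
  {p | (∃ ℓ : ℤ, 1 ≤ ℓ ∧ ℓ ≤ γmax ∧ p.2 = t - γ - ℓ ∧ Anc S X p.1) ∨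
       (∃ ℓ : ℤ, 0 ≤ ℓ ∧ ℓ ≤ γmax ∧ p.2 = t - γ - ℓ ∧ ¬ Anc S X p.1)}

/-- `Z` satisfies the backdoor criterion over all candidate FTCGs (described
by the predicate `Cand`) relative to `(x, y)`. -/
def SatisfiesBackdoorCriterionAll {V : Type*}
    (Cand : (V × ℤ → V × ℤ → Prop) → Prop)
    (Z : Set (V × ℤ)) (x y : V × ℤ) : Prop :=
  x ∉ Z ∧ y ∉ Z ∧
    ∀ F, Cand F →
      (∀ π : DPath F, π.Between x y → π.Backdoor → Blocks Z π) ∧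
      (∀ p ∈ Z, ¬ Anc F x p)

/-- The standard backdoor criterion relative to `(x, y)` in a single directed
graph: no element of `Z` is a descendant of `x`, and `Z` blocks every
backdoor path between `x` and `y`. -/
def StdBackdoorCriterion {α : Type*} (E : α → α → Prop) (Z : Set α)
    (x y : α) : Prop :=
  (∀ p ∈ Z, ¬ Anc E x p) ∧
  (∀ π : DPath E, π.Between x y → π.Backdoor → Blocks Z π)

/-- The non-endpoint vertex at position `i` σ-blocks the path given the empty
set: the edge into it from its predecessor is present but not reversible, and
likewise from its successor. -/
def DPath.SigmaBlockedAt {α : Type*} {E : α → α → Prop} (π : DPath E) (i : ℕ) : Prop :=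
  0 < i ∧ i < π.n ∧
    (E (π.w (i - 1)) (π.w i) ∧ ¬ E (π.w i) (π.w (i - 1))) ∧
    (E (π.w (i + 1)) (π.w i) ∧ ¬ E (π.w i) (π.w (i + 1)))

/-- A path is σ-active given the empty set if no non-endpoint vertex
σ-blocks it. -/
def DPath.SigmaActive {α : Type*} {E : α → α → Prop} (π : DPath E) : Prop :=
  ∀ i, ¬ π.SigmaBlockedAt i

/-- A directed cycle: vertices `w 0, …, w (m-1)` pairwise distinct, with
`w m = w 0` and edges `w i → w (i+1)`; `m = 1` is a self-loop. -/
structure DCycle {α : Type*} (E : α → α → Prop) where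
  m : ℕ
  pos : 1 ≤ m
  w : ℕ → α
  ret : w m = w 0
  inj : ∀ i j, i < m → j < m → w i = w j → i = j
  valid : ∀ i, i < m → E (w i) (w (i + 1))

/-- The cycle passes through `x`. -/
def DCycle.Through {α : Type*} {E : α → α → Prop} (c : DCycle E) (x : α) : Prop :=
  ∃ i, i < c.m ∧ c.w i = x

/-- `Cycles^>(x, E) ≠ ∅`: there is a directed cycle through `x` with at least
two distinct vertices. -/
def HasBigCycleThrough {α : Type*} (E : α → α → Prop) (x : α) : Prop :=
  ∃ c : DCycle E, c.Through x ∧ 2 ≤ c.m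

/-- The graph obtained by removing vertex `y` and all incident edges. -/
def delVertex {α : Type*} (E : α → α → Prop) (y : α) : α → α → Prop :=
  fun a b => a ≠ y ∧ b ≠ y ∧ E a b

/-- The cycle is the 2-cycle `x ⇄ y`. -/
def DCycle.IsTwoCycle {α : Type*} {E : α → α → Prop} (c : DCycle E) (x y : α) : Prop :=
  c.m = 2 ∧ ((c.w 0 = x ∧ c.w 1 = y) ∨ (c.w 0 = y ∧ c.w 1 = x))

/-- `a` and `b` lie on a common directed cycle of `E`
(`b` lies on a directed cycle through `a`). -/
def OnCommonCycle {α : Type*} (E : α → α → Prop) (a b : α) : Prop :=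
  ∃ c : DCycle E, c.Through a ∧ c.Through b

/-- A path `πf` in a candidate FTCG is compatible with a path `πs` in the SCG
`S` if every intermediate vertex `(W, u)` of `πf` satisfies: `W` is an
intermediate vertex of `πs`, or `W` lies on a directed cycle of `S` through
some intermediate vertex of `πs` but on no directed cycle of `S` through `X`. -/
def Compatible {V : Type*} {F : V × ℤ → V × ℤ → Prop} (S : V → V → Prop) (X : V)
    (πf : DPath F) (πs : DPath S) : Prop :=
  ∀ i, 0 < i → i < πf.n →
    (∃ j, 0 < j ∧ j < πs.n ∧ πs.w j = (πf.w i).1) ∨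
    (∃ j, 0 < j ∧ j < πs.n ∧ OnCommonCycle S (πs.w j) (πf.w i).1 ∧
      ¬ OnCommonCycle S X (πf.w i).1)

/-- A path in a candidate FTCG between `(X, t−γ)` and `(Y, t)` is ambiguous if
all its vertices are at times `≥ t − γ`. -/
def DPath.Ambiguous {V : Type*} {F : V × ℤ → V × ℤ → Prop} (π : DPath F)
    (t γ : ℤ) : Prop :=
  ∀ i, i ≤ π.n → t - γ ≤ (π.w i).2
theorem TemporalPriority.time_le_of_anc {V : Type*} {F : V × ℤ → V × ℤ → Prop}
    (htp : TemporalPriority F) {p q : V × ℤ} (h : Anc F p q) : p.2 ≤ q.2 := by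
  induction h with
  | refl => exact le_rfl
  | tail _ hbc ih => exact ih.trans (htp _ _ _ _ hbc).1

/-- Every parent of `(X, t - γ)` in a candidate FTCG belongs to `B_γ`. -/
theorem CandidateESCG.mem_Bset_of_parent {V : Type*} {γmax : ℤ}
    {e : (V ⊕ V) → (V ⊕ V) → Prop} {F : V × ℤ → V × ℤ → Prop}
    (hF : CandidateESCG γmax e F) {X : V} {t γ : ℤ} {p : V × ℤ}
    (h : F p (X, t - γ)) : p ∈ Bset γmax e X t γ := by
  obtain ⟨htp, hml, hct, -, rfl⟩ := hF
  obtain ⟨A, s⟩ := p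
  have hle := (htp _ _ _ _ h).1
  have hlag := hml _ _ _ _ h
  have hshift := (hct _ _ _ _ (-(t - γ))).1 h
  rw [add_neg_cancel] at hshift
  rcases hle.eq_or_lt with rfl | hlt
  · rw [add_neg_cancel] at hshift
    exact Or.inr ⟨rfl, hshift⟩
  · have hs : s + -(t - γ) = -(t - γ - s) := by ring
    rw [hs] at hshift
    exact Or.inl ⟨t - γ - s, by omega, hlag, (sub_sub_cancel _ _).symm,
      t - γ - s, by omega, hlag, hshift⟩

/-- No element of `B_γ` is a descendant of `(X, t - γ)` in a candidate FTCG. -/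
theorem CandidateESCG.not_anc_of_mem_Bset {V : Type*} {γmax : ℤ}
    {e : (V ⊕ V) → (V ⊕ V) → Prop} {F : V × ℤ → V × ℤ → Prop}
    (hF : CandidateESCG γmax e F) {X : V} {t γ : ℤ} {p : V × ℤ}
    (hp : p ∈ Bset γmax e X t γ) : ¬ Anc F (X, t - γ) p := by
  obtain ⟨htp, -, hct, hac, rfl⟩ := hF
  obtain ⟨A, s⟩ := p
  intro hanc
  have hle : t - γ ≤ s := htp.time_le_of_anc hanc
  rcases hp with ⟨ℓ, hℓ, -, hs, -⟩ | ⟨hs, hedge⟩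
  · dsimp only at hs
    omega
  · dsimp only at hs
    subst hs
    have hshift := (hct _ _ _ _ (t - γ)).1 hedge
    rw [zero_add] at hshift
    exact hac _ (Relation.TransGen.tail' hanc hshift)

/-- A set containing all parents of `x` but not `y` blocks every backdoor path
between `x` and `y`. -/
theorem DPath.blocks_of_parents_subset {α : Type*} {E : α → α → Prop} {Z : Set α}
    {x y : α} (hpar : ∀ p, E p x → p ∈ Z) (hy : y ∉ Z) (π : DPath E)
    (hπ : π.Between x y) (hback : π.Backdoor) : Blocks Z π := by
  obtain ⟨hx, hend⟩ := hπ
  have hmem : π.w 1 ∈ Z := hpar _ (hx ▸ (π.valid 0 π.pos).2 hback)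
  have hn : π.n ≠ 1 := fun h => hy (hend ▸ h.symm ▸ hmem)
  have hpos := π.pos
  exact Or.inl ⟨1, ⟨one_pos, by omega, Or.inl hback⟩, hmem⟩

/-- Theorem 1, graph-theoretic form: in an ESCG derived from an
FTCG, the set `B_γ` satisfies the backdoor criterion over all candidate
FTCGs relative to `((X, t−γ), (Y, t))`. -/
theorem escg_Bset_backdoor_criterion {V : Type*} [Fintype V] [Nonempty V]
    (γmax : ℤ) (hγmax : 1 ≤ γmax)
    (F0 : V × ℤ → V × ℤ → Prop)
    (htp : TemporalPriority F0) (hml : MaxLag γmax F0)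
    (hct : ConsistentThroughTime F0) (hac : Acyclic F0)
    (X Y : V) (hXY : X ≠ Y) (t γ : ℤ) (hγ : 0 ≤ γ)
    (hcase : 1 ≤ γ ∨ (γ = 0 ∧ ¬ derivedESCG γmax F0 (Sum.inr Y) (Sum.inr X))) :
    SatisfiesBackdoorCriterionAll (CandidateESCG γmax (derivedESCG γmax F0))
      (Bset γmax (derivedESCG γmax F0) X t γ) (X, t - γ) (Y, t) := by
  have hcand : CandidateESCG γmax (derivedESCG γmax F0) F0 := ⟨htp, hml, hct, hac, rfl⟩
  have hy : (Y, t) ∉ Bset γmax (derivedESCG γmax F0) X t γ := by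
    rintro (⟨ℓ, hℓ, -, hs, -⟩ | ⟨hs, hedge⟩)
    · dsimp only at hs
      omega
    · dsimp only at hs
      rcases hcase with hpos | ⟨-, hne⟩
      · omega
      · exact hne hedge
  exact ⟨fun hx => hcand.not_anc_of_mem_Bset hx Relation.ReflTransGen.refl, hy,
    fun F hF => ⟨DPath.blocks_of_parents_subset (fun _ => hF.mem_Bset_of_parent) hy,
      fun _ => hF.not_anc_of_mem_Bset⟩⟩
end

section
/- Let G^e be an ESCG, X ∈ V, t ∈ ℤ and γ ≥ 0 an integer. For every candidate FTCG G^f for G^e, no element of B_γ is a descendant of (X, t−γ) in G^f; that is, B_γ ∩ Desc((X,t−γ), G^f) = ∅. -/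
/-- Under temporal priority, time never decreases along a directed path. -/
theorem TemporalPriority.le_of_anc {V : Type*} {F : V × ℤ → V × ℤ → Prop}
    (hF : TemporalPriority F) {p q : V × ℤ} (h : Anc F p q) : p.2 ≤ q.2 := by
  induction h with
  | refl => exact le_rfl
  | tail _ hbc ih => exact ih.trans (hF _ _ _ _ hbc).1

/-- no element of `B_γ` is a descendant of `(X, t−γ)` in any
candidate FTCG for the ESCG `e`. -/
theorem escg_Bset_no_descendant {V : Type*} [Fintype V] [Nonempty V]
    (γmax : ℤ) (hγmax : 1 ≤ γmax)
    (e : (V ⊕ V) → (V ⊕ V) → Prop) (X : V) (t γ : ℤ) (hγ : 0 ≤ γ)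
    (F : V × ℤ → V × ℤ → Prop) (hF : CandidateESCG γmax e F) :
    ∀ p ∈ Bset γmax e X t γ, ¬ Anc F (X, t - γ) p := by
  rintro ⟨Z, s⟩ hp hanc
  obtain ⟨hT, -, hC, hA, rfl⟩ := hF
  rcases hp with ⟨ℓ, hℓ, -, hs, -⟩ | ⟨hs, hZ⟩
  · have hle := hT.le_of_anc hanc
    dsimp only at hs hle
    omega
  · obtain rfl : s = t - γ := hs
    have hedge : F (Z, t - γ) (X, t - γ) := by
      simpa using (hC Z X 0 0 (t - γ)).1 hZ
    exact hA _ (Relation.TransGen.tail' hanc hedge)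
end

section
/- Let G^e be the ESCG derived from some FTCG satisfying temporal priority, maximal lag γ_max, consistency throughout time and acyclicity. Then the densest candidate FTCG G_d^f is itself a candidate FTCG for G^e: it satisfies temporal priority, maximal lag γ_max, consistency throughout time and acyclicity, and its derived ESCG is G^e. -/
theorem temporalPriority_densestFTCG {V : Type*} {γmax : ℤ} {F : V × ℤ → V × ℤ → Prop}
    (htp : TemporalPriority F) :
    TemporalPriority (densestFTCG γmax (derivedESCG γmax F)) := by
  rintro A B s t (⟨hst, he⟩ | ⟨l, hl, -, hst, -⟩)
  · simp only at hst
    exact ⟨hst.le, fun hAB => absurd ((htp A B 0 0 he).2 hAB) (lt_irrefl 0)⟩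
  · simp only at hst
    exact ⟨by lia, fun _ => by lia⟩

theorem maxLag_densestFTCG {V : Type*} {γmax : ℤ} (hγmax : 0 ≤ γmax)
    (e : V ⊕ V → V ⊕ V → Prop) : MaxLag γmax (densestFTCG γmax e) := by
  rintro A B s t (⟨hst, -⟩ | ⟨l, -, hl, hst, -⟩) <;> simp only at hst <;> lia

theorem consistentThroughTime_densestFTCG {V : Type*} (γmax : ℤ)
    (e : V ⊕ V → V ⊕ V → Prop) : ConsistentThroughTime (densestFTCG γmax e) := by
  intro A B s t k
  have hshift (l : ℤ) : s = t - l ↔ s + k = t + k - l := by lia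
  simp only [densestFTCG, add_left_inj, hshift]

/-- An edge of the densest FTCG either strictly increases time or is an instantaneous edge
of the original graph. -/
theorem lt_or_edge_of_densestFTCG {V : Type*} {γmax : ℤ} {F : V × ℤ → V × ℤ → Prop}
    (hct : ConsistentThroughTime F) {p q : V × ℤ}
    (h : densestFTCG γmax (derivedESCG γmax F) p q) :
    p.2 < q.2 ∨ p.2 = q.2 ∧ F p q := by
  obtain ⟨A, s⟩ := p
  obtain ⟨B, t⟩ := q
  rcases h with ⟨hst, he⟩ | ⟨l, hl, -, hst, -⟩
  · obtain rfl : s = t := hst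
    exact Or.inr ⟨rfl, by simpa using (hct A B 0 0 s).1 he⟩
  · simp only at hst
    exact Or.inl (by simp only; lia)

theorem acyclic_densestFTCG {V : Type*} {γmax : ℤ} {F : V × ℤ → V × ℤ → Prop}
    (hct : ConsistentThroughTime F) (hac : Acyclic F) :
    Acyclic (densestFTCG γmax (derivedESCG γmax F)) := by
  have hpath {p q : V × ℤ}
      (h : Relation.TransGen (densestFTCG γmax (derivedESCG γmax F)) p q) :
      p.2 < q.2 ∨ p.2 = q.2 ∧ Relation.TransGen F p q := by
    induction h with
    | single h => exact (lt_or_edge_of_densestFTCG hct h).imp_right (.imp_right .single)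
    | tail _ h ih =>
      rcases ih with ih | ⟨ih, hF⟩ <;>
        rcases lt_or_edge_of_densestFTCG hct h with h' | ⟨h', hF'⟩
      · exact Or.inl (ih.trans h')
      · exact Or.inl (h' ▸ ih)
      · exact Or.inl (ih ▸ h')
      · exact Or.inr ⟨ih.trans h', hF.tail hF'⟩
  exact fun v hv => (hpath hv).elim (lt_irrefl _) fun h => hac v h.2

theorem derivedESCG_densestFTCG {V : Type*} (γmax : ℤ) (F : V × ℤ → V × ℤ → Prop) :
    derivedESCG γmax (densestFTCG γmax (derivedESCG γmax F)) = derivedESCG γmax F := by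
  funext a b
  rcases a with A | A <;> rcases b with B | B <;> apply propext
  · exact Iff.rfl
  · constructor
    · rintro ⟨γ, h1, -, ⟨h, -⟩ | ⟨-, -, -, -, he⟩⟩
      · simp only at h
        lia
      · exact he
    · rintro ⟨γ, h1, h2, h⟩
      exact ⟨γ, h1, h2, Or.inr ⟨γ, h1, h2, by simp, γ, h1, h2, h⟩⟩
  · exact Iff.rfl
  · constructor
    · rintro (⟨-, he⟩ | ⟨l, hl, -, h, -⟩)
      · exact he
      · simp only at h
        lia
    · exact fun h => Or.inl ⟨rfl, h⟩

/-- the densest candidate FTCG for an ESCG derived from some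
FTCG is itself a candidate FTCG for that ESCG. -/
theorem densest_is_candidate {V : Type*} [Fintype V] [Nonempty V]
    (γmax : ℤ) (hγmax : 1 ≤ γmax)
    (F0 : V × ℤ → V × ℤ → Prop)
    (htp : TemporalPriority F0) (hml : MaxLag γmax F0)
    (hct : ConsistentThroughTime F0) (hac : Acyclic F0) :
    CandidateESCG γmax (derivedESCG γmax F0)
      (densestFTCG γmax (derivedESCG γmax F0)) := by
  exact ⟨temporalPriority_densestFTCG htp, maxLag_densestFTCG (by lia) _,
    consistentThroughTime_densestFTCG γmax _, acyclic_densestFTCG hct hac,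
    derivedESCG_densestFTCG γmax F0⟩
end

section
/- Let G^e be the ESCG derived from some FTCG satisfying temporal priority, maximal lag γ_max, consistency throughout time and acyclicity; let X, Y ∈ V be distinct, t ∈ ℤ and γ ≥ 0 an integer. Every set Z ⊆ V × ℤ with (X,t−γ), (Y,t) ∉ Z that satisfies the standard backdoor criterion relative to ((X,t−γ),(Y,t)) in the densest candidate FTCG G_d^f also satisfies the backdoor criterion over all candidate FTCGs relative to ((X,t−γ),(Y,t)). (Proposition 1: any adjustment set satisfying the standard backdoor criterion on the densest candidate FTCG is valid for all candidate FTCGs.) -/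
theorem Anc.mono {α : Type*} {E E' : α → α → Prop} (h : ∀ a b, E a b → E' a b) {u v : α}
    (huv : Anc E u v) : Anc E' u v :=
  Relation.ReflTransGen.mono h _ _ huv

/-- The backdoor criterion is inherited by subgraphs on the same vertices. -/
theorem StdBackdoorCriterion.anti {α : Type*} {E E' : α → α → Prop}
    (h : ∀ a b, E a b → E' a b) {Z : Set α} {x y : α}
    (hstd : StdBackdoorCriterion E' Z x y) : StdBackdoorCriterion E Z x y := by
  refine ⟨fun p hp hxp => hstd.1 p hp (hxp.mono h), fun π hπ hb => ?_⟩
  rcases hstd.2 (π.map h) hπ hb with hnc | ⟨i, hi, hz⟩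
  · exact Or.inl hnc
  · exact Or.inr ⟨i, hi, fun z hzZ hanc => hz z hzZ (hanc.mono h)⟩

/-- Every candidate FTCG is a subgraph of the densest one. -/
theorem CandidateESCG.le_densestFTCG {V : Type*} {γmax : ℤ} {e : (V ⊕ V) → (V ⊕ V) → Prop}
    {F : V × ℤ → V × ℤ → Prop} (hF : CandidateESCG γmax e F) (p q : V × ℤ) (hpq : F p q) :
    densestFTCG γmax e p q := by
  obtain ⟨htp, hml, hct, -, rfl⟩ := hF
  obtain ⟨A, s⟩ := p
  obtain ⟨B, t⟩ := q
  have hle := (htp A B s t hpq).1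
  have hlag := hml A B s t hpq
  have hshift := (hct A B s t (-t)).1 hpq
  rw [add_neg_cancel] at hshift
  rcases hle.eq_or_lt with rfl | hlt
  · rw [add_neg_cancel] at hshift
    exact Or.inl ⟨rfl, hshift⟩
  · refine Or.inr ⟨t - s, by omega, hlag, by simp, t - s, by omega, hlag, ?_⟩
    rwa [neg_sub, sub_eq_add_neg]

/-- Proposition 1, graph-theoretic form: any set satisfying the
standard backdoor criterion on the densest candidate FTCG satisfies the
backdoor criterion over all candidate FTCGs. -/
theorem std_bdc_densest_implies_all {V : Type*} [Fintype V] [Nonempty V]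
    (γmax : ℤ) (hγmax : 1 ≤ γmax)
    (F0 : V × ℤ → V × ℤ → Prop)
    (htp : TemporalPriority F0) (hml : MaxLag γmax F0)
    (hct : ConsistentThroughTime F0) (hac : Acyclic F0)
    (X Y : V) (hXY : X ≠ Y) (t γ : ℤ) (hγ : 0 ≤ γ)
    (Z : Set (V × ℤ)) (hx : (X, t - γ) ∉ Z) (hy : (Y, t) ∉ Z)
    (hstd : StdBackdoorCriterion (densestFTCG γmax (derivedESCG γmax F0)) Z
      (X, t - γ) (Y, t)) :
    SatisfiesBackdoorCriterionAll (CandidateESCG γmax (derivedESCG γmax F0)) Z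
      (X, t - γ) (Y, t) := by
  exact ⟨hx, hy, fun _ hF => (hstd.anti hF.le_densestFTCG).symm⟩
end

section
/- Let G^s be a directed graph on V and G^f a candidate FTCG for G^s. If X is not an ancestor of Y in G^s, then for every t ∈ ℤ and every integer γ ≥ 0, the vertex (X, t−γ) is not an ancestor of (Y, t) in G^f. (Graph-theoretic content of Lemma 1: if X ∉ Anc(Y, G^s) then the total effect P(y_t | do(x_{t−γ})) is identifiable and equals P(y_t).) -/
/-- Every edge of an FTCG projects to an edge of its derived SCG. -/
theorem derivedSCG_of_edge {V : Type*} {γmax : ℤ} {F : V × ℤ → V × ℤ → Prop}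
    (hprio : TemporalPriority F) (hlag : MaxLag γmax F) {p q : V × ℤ} (h : F p q) :
    derivedSCG γmax F p.1 q.1 := by
  obtain ⟨A, s⟩ := p
  obtain ⟨B, t⟩ := q
  refine ⟨t, t - s, sub_nonneg.mpr (hprio A B s t h).1, hlag A B s t h, ?_⟩
  rwa [sub_sub_cancel]

/-- Lemma 1, graph-theoretic content: if `X` is not an ancestor
of `Y` in the SCG, then `(X, t−γ)` is not an ancestor of `(Y, t)` in any
candidate FTCG. -/
theorem scg_not_anc_ftcg_not_anc {V : Type*} [Fintype V] [Nonempty V]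
    (γmax : ℤ) (hγmax : 1 ≤ γmax)
    (S : V → V → Prop)
    (F : V × ℤ → V × ℤ → Prop) (hF : CandidateSCG γmax S F)
    (X Y : V) (hna : ¬ Anc S X Y) :
    ∀ t γ : ℤ, 0 ≤ γ → ¬ Anc F (X, t - γ) (Y, t) := by
  obtain ⟨hprio, hlag, -, -, rfl⟩ := hF
  intro t γ _ hanc
  exact hna (hanc.lift Prod.fst fun _ _ => derivedSCG_of_edge hprio hlag)
end

section
/- Let G^f be an FTCG satisfying consistency throughout time and maximal lag γ_max, and let G^s be its derived SCG. If X is an ancestor of Y in G^s, then for every t ∈ ℤ there exists an integer γ ≥ 0 such that (X, t−γ) is an ancestor of (Y, t) in G^f. -/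
/-- if `X` is an ancestor of `Y` in the SCG derived from a
consistent FTCG with maximal lag `γmax`, then for every `t` there is a lag
`γ ≥ 0` with `(X, t−γ)` an ancestor of `(Y, t)` in the FTCG. -/
theorem scg_anc_lifts_to_ftcg {V : Type*} [Fintype V] [Nonempty V]
    (γmax : ℤ) (hγmax : 1 ≤ γmax)
    (F : V × ℤ → V × ℤ → Prop)
    (hct : ConsistentThroughTime F) (hml : MaxLag γmax F)
    (X Y : V) (h : Anc (derivedSCG γmax F) X Y) (t : ℤ) :
    ∃ γ : ℤ, 0 ≤ γ ∧ Anc F (X, t - γ) (Y, t) := by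
  induction h using Relation.ReflTransGen.head_induction_on with
  | refl => exact ⟨0, le_rfl, by rw [sub_zero]; exact Relation.ReflTransGen.refl⟩
  | head hAB _ ih =>
    obtain ⟨s, δ, hδ, -, hF⟩ := hAB
    obtain ⟨γ, hγ, hanc⟩ := ih
    refine ⟨γ + δ, add_nonneg hγ hδ, Relation.ReflTransGen.head ?_ hanc⟩
    convert (hct _ _ _ _ (t - γ - s)).1 hF using 2 <;> ring
end

section
/- Let G^s be an SCG, X, Y ∈ V with X an ancestor of Y in G^s, t ∈ ℤ, γ ≥ 0 an integer, and let G^f be a candidate FTCG for G^s. Let π^f be a backdoor path between (X, t−γ) and (Y, t) in G^f containing some vertex at a time strictly less than t−γ (i.e. π^f is not an ambiguous path). Then π^f contains a definite non-collider (W, u) with t−γ−γ_max ≤ u ≤ t−γ−1; every such vertex belongs to A_γ and is not a descendant of (X, t−γ) in G^f; consequently A_γ blocks π^f. (Property 1.) -/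
/-- The last vertex of a path before time `s`, when the path starts and ends at times `≥ s`,
is a definite non-collider at most `γmax` before `s`. -/
theorem DPath.exists_defNonColliderAt_before {V : Type*} {γmax : ℤ}
    {F : V × ℤ → V × ℤ → Prop} (hT : TemporalPriority F) (hL : MaxLag γmax F)
    (π : DPath F) {s : ℤ} (h0 : s ≤ (π.w 0).2) (hn : s ≤ (π.w π.n).2)
    (hpast : ∃ i, i ≤ π.n ∧ (π.w i).2 < s) :
    ∃ i, π.DefNonColliderAt i ∧ s - γmax ≤ (π.w i).2 ∧ (π.w i).2 ≤ s - 1 := by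
  obtain ⟨j, hj, hjs⟩ := hpast
  set i := Nat.findGreatest (fun k => (π.w k).2 < s) π.n
  have his : (π.w i).2 < s := Nat.findGreatest_spec (P := fun k => (π.w k).2 < s) hj hjs
  have hile : i ≤ π.n := Nat.findGreatest_le _
  have hipos : 0 < i := Nat.pos_of_ne_zero fun h => by rw [h] at his; omega
  have hilt : i < π.n := lt_of_le_of_ne hile fun h => by rw [h] at his; omega
  have hnext : s ≤ (π.w (i + 1)).2 :=
    not_lt.mp (Nat.findGreatest_is_greatest (P := fun k => (π.w k).2 < s)
      (Nat.lt_succ_self i) hilt)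
  have hdir : π.dir i = true := by
    by_contra h
    have : (π.w (i + 1)).2 ≤ (π.w i).2 :=
      (hT _ _ _ _ ((π.valid i hilt).2 (Bool.eq_false_iff.mpr h))).1
    omega
  have hlag : (π.w (i + 1)).2 - (π.w i).2 ≤ γmax := hL _ _ _ _ ((π.valid i hilt).1 hdir)
  exact ⟨i, ⟨hipos, hilt, Or.inr hdir⟩, by omega, by omega⟩

/-- Every vertex within `γmax` strictly before time `t - γ` lies in `A_γ`. -/
theorem mem_Aset_of_before {V : Type*} {γmax : ℤ} (S : V → V → Prop) (X : V) {t γ : ℤ}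
    {p : V × ℤ} (h₁ : t - γ - γmax ≤ p.2) (h₂ : p.2 ≤ t - γ - 1) :
    p ∈ Aset γmax S X t γ := by
  by_cases h : Anc S X p.1
  · exact Or.inl ⟨t - γ - p.2, by omega, by omega, by omega, h⟩
  · exact Or.inr ⟨t - γ - p.2, by omega, by omega, by omega, h⟩

/-- Property 1: a non-ambiguous backdoor path between
`(X, t−γ)` and `(Y, t)` in a candidate FTCG contains a definite non-collider
at a time in `[t−γ−γmax, t−γ−1]`; every such vertex belongs to `A_γ` and is
not a descendant of `(X, t−γ)`; consequently `A_γ` blocks the path. -/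
theorem nonambiguous_backdoor_blocked {V : Type*} [Fintype V] [Nonempty V]
    (γmax : ℤ) (hγmax : 1 ≤ γmax)
    (S : V → V → Prop) (X Y : V) (hanc : Anc S X Y) (t γ : ℤ) (hγ : 0 ≤ γ)
    (F : V × ℤ → V × ℤ → Prop) (hF : CandidateSCG γmax S F)
    (π : DPath F) (hb : π.Between (X, t - γ) (Y, t)) (hbd : π.Backdoor)
    (hpast : ∃ i, i ≤ π.n ∧ (π.w i).2 < t - γ) :
    (∃ i, π.DefNonColliderAt i ∧
        t - γ - γmax ≤ (π.w i).2 ∧ (π.w i).2 ≤ t - γ - 1) ∧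
    (∀ i, π.DefNonColliderAt i →
        t - γ - γmax ≤ (π.w i).2 → (π.w i).2 ≤ t - γ - 1 →
        π.w i ∈ Aset γmax S X t γ ∧ ¬ Anc F (X, t - γ) (π.w i)) ∧
    Blocks (Aset γmax S X t γ) π := by
  obtain ⟨hT, hL, -⟩ := hF
  obtain ⟨h0, hn⟩ := hb
  have hex := π.exists_defNonColliderAt_before hT hL (s := t - γ) (by simp [h0])
    (by simp [hn, hγ]) hpast
  refine ⟨hex, fun i _ h₁ h₂ => ⟨mem_Aset_of_before S X h₁ h₂, fun h => ?_⟩, ?_⟩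
  · have : t - γ ≤ (π.w i).2 := hT.le_of_anc h
    omega
  · obtain ⟨i, hi, h₁, h₂⟩ := hex
    exact Or.inl ⟨i, hi, mem_Aset_of_before S X h₁ h₂⟩
end
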